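/- arXiv:math/9702203 — 2 statements merged into one kernel-verified Lean document; each statement's English description precedes it below -/
import Mathlib

section
/- For all natural numbers d, e, f with 0 < e ≤ d, the element x^d (x^τ)^e y^f of H (where x^τ = τ⁻¹xτ) satisfies ℓ(x^d (x^τ)^e y^f) = d + e + f + 2. -/
/-! Generators and presentations for the groups `H` and `G` of Neumann–Shapiro. -/

inductive GenH : Type
  | x | y | t | tau
  deriving DecidableEq

inductive GenG : Type
  | x | y | s | t
  deriving DecidableEq

namespace NS

open FreeGroup

/-- Conjugation `a^b = b⁻¹ a b` in a group. -/
def cnj {Γ : Type*} [Group Γ] (a b : Γ) : Γ := b⁻¹ * a * b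

/-! ### The group `H` -/

abbrev FH := FreeGroup GenH

def fx : FH := FreeGroup.of GenH.x
def fy : FH := FreeGroup.of GenH.y
def ft : FH := FreeGroup.of GenH.t
def ftau : FH := FreeGroup.of GenH.tau

/-- The eight elements `x, x^t, x^τ, x^{tτ}, y, y^t, y^τ, y^{tτ}` (as words). -/
def basisH : List FH :=
  [fx, cnj fx ft, cnj fx ftau, cnj fx (ft * ftau),
   fy, cnj fy ft, cnj fy ftau, cnj fy (ft * ftau)]

/-- Relators of `H`: `t² = τ² = [τ,t] = 1`, the eight elements of `basisH` pairwise
commute, and `x · x^τ = y · y^t`. -/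
def relsH : Set FH :=
  {ft ^ 2, ftau ^ 2, ftau⁻¹ * ft⁻¹ * ftau * ft} ∪
    {r | ∃ a ∈ basisH, ∃ b ∈ basisH, r = a * b * a⁻¹ * b⁻¹} ∪
    {fx * cnj fx ftau * (fy * cnj fy ft)⁻¹}

abbrev H := PresentedGroup relsH

def Hx : H := PresentedGroup.of GenH.x
def Hy : H := PresentedGroup.of GenH.y
def Ht : H := PresentedGroup.of GenH.t
def Htau : H := PresentedGroup.of GenH.tau

/-! ### The group `G` -/

abbrev FG := FreeGroup GenG

def gx : FG := FreeGroup.of GenG.x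
def gy : FG := FreeGroup.of GenG.y
def gs : FG := FreeGroup.of GenG.s
def gt : FG := FreeGroup.of GenG.t

/-- The eight conjugating elements `1, s, s², s³, t, ts, ts², ts³`. -/
def conjsG : List FG := [1, gs, gs ^ 2, gs ^ 3, gt, gt * gs, gt * gs ^ 2, gt * gs ^ 3]

/-- The sixteen elements `x^α, y^α` for `α ∈ {1, s, s², s³, t, ts, ts², ts³}`. -/
def basisG : List FG :=
  conjsG.map (fun b => cnj gx b) ++ conjsG.map (fun b => cnj gy b)

/-- Relators of `G`: `t² = s⁴ = [s,t] = 1`, the sixteen elements of `basisG` pairwise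
commute, and `x · x^{s²} = y · y^t`. -/
def relsG : Set FG :=
  {gt ^ 2, gs ^ 4, gs⁻¹ * gt⁻¹ * gs * gt} ∪
    {r | ∃ a ∈ basisG, ∃ b ∈ basisG, r = a * b * a⁻¹ * b⁻¹} ∪
    {gx * cnj gx (gs ^ 2) * (gy * cnj gy gt)⁻¹}

abbrev G := PresentedGroup relsG

def Gx : G := PresentedGroup.of GenG.x
def Gy : G := PresentedGroup.of GenG.y
def Gs : G := PresentedGroup.of GenG.s
def Gt : G := PresentedGroup.of GenG.t

/-! ### Words, evaluation, lengths, geodesics -/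

/-- A word over the symmetric alphabet on `α`: a letter `(a, true)` stands for the
generator `a` and `(a, false)` for its inverse. -/
abbrev Word (α : Type) := List (α × Bool)

/-- Evaluate a word in a group, given the images of the generators. -/
def evalWith {α : Type} {Γ : Type*} [Group Γ] (f : α → Γ) (w : Word α) : Γ :=
  (w.map fun p => if p.2 then f p.1 else (f p.1)⁻¹).prod

/-- Evaluation of a word over `X_H = {x^{±1}, y^{±1}, t^{±1}, τ^{±1}}` in `H`. -/
def evalH : Word GenH → H := evalWith (fun a => (PresentedGroup.of a : H))

/-- Evaluation of a word over `X = {x^{±1}, y^{±1}, t^{±1}, s^{±1}}` in `G`. -/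
def evalG : Word GenG → G := evalWith (fun a => (PresentedGroup.of a : G))

/-- Weight of a letter for `H`: the letters `x^{±1}, y^{±1}, t^{±1}` have length `1`
and `τ^{±1}` has length `2`. -/
def wtH : GenH × Bool → ℕ
  | (GenH.tau, _) => 2
  | _ => 1

/-- Weighted length of a word over `X_H`. -/
def wlenH (w : Word GenH) : ℕ := (w.map wtH).sum

/-- `ℓ(h)`: the minimum weighted length of a word over `X_H` evaluating to `h`. -/
noncomputable def ellH (h : H) : ℕ := sInf {n | ∃ w : Word GenH, evalH w = h ∧ wlenH w = n}

/-- A word over `X_H` is geodesic if its weighted length is `ℓ` of its evaluation. -/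
def IsGeodesicH (w : Word GenH) : Prop := wlenH w = ellH (evalH w)

/-- `ℓ_G(g)`: the minimum length (number of letters) of a word over `X` evaluating to `g`. -/
noncomputable def ellG (g : G) : ℕ := sInf {n | ∃ w : Word GenG, evalG w = g ∧ w.length = n}

/-- A word over `X` is geodesic if its length is `ℓ_G` of its evaluation. -/
def IsGeodesicG (w : Word GenG) : Prop := w.length = ellG (evalG w)

end NS

namespace NS

/-! ### Homomorphisms out of `H` -/

theorem lift_eq_one_of_mem_relsH {Γ : Type*} [Group Γ] {F : GenH → Γ}
    (ht : F .t ^ 2 = 1) (htau : F .tau ^ 2 = 1)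
    (hcomm : (F .tau)⁻¹ * (F .t)⁻¹ * F .tau * F .t = 1)
    (hbasis : ∀ a ∈ basisH, ∀ b ∈ basisH, Commute (FreeGroup.lift F a) (FreeGroup.lift F b))
    (hxy : F .x * cnj (F .x) (F .tau) = F .y * cnj (F .y) (F .t)) :
    ∀ r ∈ relsH, FreeGroup.lift F r = 1 := by
  rintro r (((rfl | rfl | rfl) | ⟨a, ha, b, hb, rfl⟩) | rfl)
  · simpa [ft] using ht
  · simpa [ftau] using htau
  · simpa [ft, ftau] using hcomm
  · simp [(hbasis a ha b hb).eq]
  · simpa [fx, fy, ft, ftau, cnj, mul_inv_eq_one, ← mul_assoc] using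
      mul_inv_eq_one.2 hxy

/-- The homomorphism sending `x` and `y` to `1 : ℤ` and killing `t` and `τ`. -/
def exponentSum : H →* Multiplicative ℤ :=
  PresentedGroup.toGroup
    (f := fun | .x | .y => Multiplicative.ofAdd 1 | .t | .tau => 1)
    (lift_eq_one_of_mem_relsH (by simp) (by simp) (by simp)
      (fun _ _ _ _ => Commute.all _ _) (by simp [cnj]))

/-- The homomorphism recording the parity of the number of letters `t`. -/
def tSign : H →* ℤˣ :=
  PresentedGroup.toGroup
    (f := fun | .t => -1 | .x | .y | .tau => 1)
    (lift_eq_one_of_mem_relsH (by simp) (by simp) (by simp)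
      (fun _ _ _ _ => Commute.all _ _) (by simp [cnj]))

open DihedralGroup in
/-- The homomorphism to the infinite dihedral group with `x` a rotation, `τ` a reflection,
killing `y` and `t`. -/
def xDihedral : H →* DihedralGroup 0 :=
  PresentedGroup.toGroup
    (f := fun | .x => r 1 | .tau => sr 0 | .y | .t => 1)
    (lift_eq_one_of_mem_relsH (by simp) (by simp [sq]) (by simp)
      (by simp [basisH, fx, fy, ft, ftau, cnj, Commute, SemiconjBy])
      (by simp [cnj]))

open DihedralGroup in
/-- The homomorphism to the infinite dihedral group with `y` a rotation, `t` a reflection,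
killing `x` and `τ`. -/
def yDihedral : H →* DihedralGroup 0 :=
  PresentedGroup.toGroup
    (f := fun | .y => r 1 | .t => sr 0 | .x | .tau => 1)
    (lift_eq_one_of_mem_relsH (by simp [sq]) (by simp) (by simp)
      (by simp [basisH, fx, fy, ft, ftau, cnj, Commute, SemiconjBy])
      (by simp [cnj]))

section generators

@[simp] theorem of_x_eq_Hx : (PresentedGroup.of .x : H) = Hx := rfl
@[simp] theorem of_y_eq_Hy : (PresentedGroup.of .y : H) = Hy := rfl
@[simp] theorem of_t_eq_Ht : (PresentedGroup.of .t : H) = Ht := rfl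
@[simp] theorem of_tau_eq_Htau : (PresentedGroup.of .tau : H) = Htau := rfl

open DihedralGroup

@[simp] theorem exponentSum_Hx : exponentSum Hx = Multiplicative.ofAdd 1 :=
  PresentedGroup.toGroup.of _
@[simp] theorem exponentSum_Hy : exponentSum Hy = Multiplicative.ofAdd 1 :=
  PresentedGroup.toGroup.of _
@[simp] theorem exponentSum_Ht : exponentSum Ht = 1 := PresentedGroup.toGroup.of _
@[simp] theorem exponentSum_Htau : exponentSum Htau = 1 := PresentedGroup.toGroup.of _

@[simp] theorem tSign_Hx : tSign Hx = 1 := PresentedGroup.toGroup.of _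
@[simp] theorem tSign_Hy : tSign Hy = 1 := PresentedGroup.toGroup.of _
@[simp] theorem tSign_Ht : tSign Ht = -1 := PresentedGroup.toGroup.of _
@[simp] theorem tSign_Htau : tSign Htau = 1 := PresentedGroup.toGroup.of _

@[simp] theorem xDihedral_Hx : xDihedral Hx = r 1 := PresentedGroup.toGroup.of _
@[simp] theorem xDihedral_Hy : xDihedral Hy = 1 := PresentedGroup.toGroup.of _
@[simp] theorem xDihedral_Htau : xDihedral Htau = sr 0 := PresentedGroup.toGroup.of _

@[simp] theorem yDihedral_Hx : yDihedral Hx = 1 := PresentedGroup.toGroup.of _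
@[simp] theorem yDihedral_Hy : yDihedral Hy = r 1 := PresentedGroup.toGroup.of _
@[simp] theorem yDihedral_Htau : yDihedral Htau = 1 := PresentedGroup.toGroup.of _

end generators

/-! ### Relations in `H` -/

theorem mk_basisH_commute {a b : FH} (ha : a ∈ basisH) (hb : b ∈ basisH) :
    Commute (PresentedGroup.mk relsH a) (PresentedGroup.mk relsH b) := by
  have h := PresentedGroup.one_of_mem (rels := relsH) (x := a * b * a⁻¹ * b⁻¹)
    (Or.inl (Or.inr ⟨a, ha, b, hb, rfl⟩))
  simp only [map_mul, map_inv, mul_inv_eq_iff_eq_mul, one_mul] at h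
  exact h

theorem Hx_commute_cnj_Hx_Htau : Commute Hx (cnj Hx Htau) :=
  mk_basisH_commute (a := fx) (b := cnj fx ftau) (by simp [basisH]) (by simp [basisH])

theorem Hy_commute_cnj_Hy_Ht : Commute Hy (cnj Hy Ht) :=
  mk_basisH_commute (a := fy) (b := cnj fy ft) (by simp [basisH]) (by simp [basisH])

theorem Hx_mul_cnj_Hx_Htau : Hx * cnj Hx Htau = Hy * cnj Hy Ht :=
  mul_inv_eq_one.1 <| PresentedGroup.one_of_mem (rels := relsH)
    (x := fx * cnj fx ftau * (fy * cnj fy ft)⁻¹) (Or.inr rfl)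

theorem cnj_pow {Γ : Type*} [Group Γ] (a b : Γ) (n : ℕ) : cnj a b ^ n = cnj (a ^ n) b := by
  simpa [cnj] using conj_pow (a := b⁻¹) (b := a) (i := n)

theorem Hx_pow_mul_cnj_pow_mul_Hy_pow {d e : ℕ} (f : ℕ) (hed : e ≤ d) :
    Hx ^ d * cnj Hx Htau ^ e * Hy ^ f = Hx ^ (d - e) * Hy ^ (f + e) * Ht⁻¹ * Hy ^ e * Ht := by
  calc Hx ^ d * cnj Hx Htau ^ e * Hy ^ f
      = Hx ^ (d - e) * (Hx * cnj Hx Htau) ^ e * Hy ^ f := by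
        rw [Hx_commute_cnj_Hx_Htau.mul_pow, ← mul_assoc, ← pow_add, Nat.sub_add_cancel hed]
    _ = Hx ^ (d - e) * (cnj Hy Ht ^ e * Hy ^ (e + f)) := by
        rw [Hx_mul_cnj_Hx_Htau, Hy_commute_cnj_Hy_Ht.eq, Hy_commute_cnj_Hy_Ht.symm.mul_pow,
          pow_add]
        simp only [mul_assoc]
    _ = Hx ^ (d - e) * Hy ^ (f + e) * Ht⁻¹ * Hy ^ e * Ht := by
        rw [← (Hy_commute_cnj_Hy_Ht.pow_pow (e + f) e).eq, cnj_pow, cnj, add_comm e f]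
        simp only [mul_assoc]

/-! ### Lengths of words -/

@[simp] theorem evalH_nil : evalH [] = 1 := rfl

@[simp] theorem evalH_cons (p : GenH × Bool) (w : Word GenH) :
    evalH (p :: w) =
      (if p.2 then PresentedGroup.of p.1 else (PresentedGroup.of p.1)⁻¹) * evalH w := by
  simp [evalH, evalWith]

@[simp] theorem wlenH_nil : wlenH [] = 0 := rfl

@[simp] theorem wlenH_cons (p : GenH × Bool) (w : Word GenH) :
    wlenH (p :: w) = wtH p + wlenH w := by
  simp [wlenH]

theorem ellH_le_wlenH (w : Word GenH) : ellH (evalH w) ≤ wlenH w :=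
  Nat.sInf_le ⟨w, rfl, rfl⟩

theorem exists_wlenH_eq_ellH_evalH (w : Word GenH) :
    ∃ v, evalH v = evalH w ∧ wlenH v = ellH (evalH w) :=
  Nat.sInf_mem (s := {n | ∃ v, evalH v = evalH w ∧ wlenH v = n}) ⟨_, w, rfl, rfl⟩

/-- Weight of the letters `t^{±1}` and `τ^{±1}` in a word. -/
def torsionWeight : Word GenH → ℕ
  | [] => 0
  | (.x, _) :: w | (.y, _) :: w => torsionWeight w
  | (.t, _) :: w => torsionWeight w + 1
  | (.tau, _) :: w => torsionWeight w + 2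

theorem exponentSum_add_torsionWeight_le (w : Word GenH) :
    (exponentSum (evalH w)).toAdd + torsionWeight w ≤ wlenH w := by
  induction w with
  | nil => simp [torsionWeight]
  | cons p w ih =>
    obtain ⟨_ | _ | _ | _, _ | _⟩ := p <;>
    simp [torsionWeight, wtH] <;> omega

open DihedralGroup in
theorem exists_of_torsionWeight_eq_zero {w : Word GenH} (hw : torsionWeight w = 0) :
    tSign (evalH w) = 1 ∧ ∃ a b : ℤ, (exponentSum (evalH w)).toAdd = a + b ∧
      xDihedral (evalH w) = r a ∧ yDihedral (evalH w) = r b := by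
  induction w with
  | nil => exact ⟨by simp, 0, 0, by simp, by simp; rfl, by simp; rfl⟩
  | cons p w ih =>
    obtain ⟨_ | _ | _ | _, s⟩ := p
    · obtain ⟨h, a, b, h1, h2, h3⟩ := ih hw
      refine ⟨?_, (if s then 1 else -1) + a, b, ?_, ?_, ?_⟩ <;> cases s <;>
      simp [h, h1, h2, h3, add_assoc]
      all_goals rfl
    · obtain ⟨h, a, b, h1, h2, h3⟩ := ih hw
      refine ⟨?_, a, (if s then 1 else -1) + b, ?_, ?_, ?_⟩ <;> cases s <;>
      simp [h, h1, h2, h3, add_left_comm]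
      all_goals rfl
    · simp [torsionWeight] at hw
    · simp [torsionWeight] at hw

theorem tSign_of_torsionWeight_eq_one {w : Word GenH} (hw : torsionWeight w = 1) :
    tSign (evalH w) = -1 := by
  induction w with
  | nil => simp [torsionWeight] at hw
  | cons p w ih =>
    obtain ⟨_ | _ | _ | _, s⟩ := p
    · cases s <;> simp [ih hw]
    · cases s <;> simp [ih hw]
    · cases s <;>
      simp [(exists_of_torsionWeight_eq_zero (w := w) (by simpa [torsionWeight] using hw)).1]
    · simp [torsionWeight] at hw

theorem le_wlenH_of_evalH_eq {d e f : ℕ} (he : 0 < e) {w : Word GenH}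
    (hw : evalH w = Hx ^ d * cnj Hx Htau ^ e * Hy ^ f) : d + e + f + 2 ≤ wlenH w := by
  have hsum : (exponentSum (evalH w)).toAdd = d + e + f := by simp [hw, cnj]
  have hle := exponentSum_add_torsionWeight_le w
  have h0 : torsionWeight w ≠ 0 := fun h => by
    obtain ⟨-, a, b, h1, h2, h3⟩ := exists_of_torsionWeight_eq_zero h
    have hx : a = d - e := by
      simp [hw, cnj] at h2
      exact (DihedralGroup.r.inj h2).symm
    have hy : b = f := by
      simp [hw, cnj] at h3
      exact (DihedralGroup.r.inj h3).symm
    omega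
  have h1 : torsionWeight w ≠ 1 := fun h => by
    have := tSign_of_torsionWeight_eq_one h
    simp [hw, cnj] at this
  omega

theorem exists_evalH_eq_wlenH_eq {d e : ℕ} (f : ℕ) (hed : e ≤ d) :
    ∃ w, evalH w = Hx ^ d * cnj Hx Htau ^ e * Hy ^ f ∧ wlenH w = d + e + f + 2 := by
  refine ⟨List.replicate (d - e) (.x, true) ++ List.replicate (f + e) (.y, true) ++ [(.t, false)] ++
    List.replicate e (.y, true) ++ [(.t, true)], ?_, ?_⟩
  · rw [Hx_pow_mul_cnj_pow_mul_Hy_pow f hed]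
    simp [evalH, evalWith, mul_assoc]
  · simp [wlenH, wtH]
    omega

end NS

open NS in
/-- For natural numbers `d, e, f` with `0 < e ≤ d`,
`ℓ(x^d (x^τ)^e y^f) = d + e + f + 2`. -/
theorem ell_xd_xtaue_yf_of_le (d e f : ℕ) (he : 0 < e) (hed : e ≤ d) :
    ellH (Hx ^ d * (cnj Hx Htau) ^ e * Hy ^ f) = d + e + f + 2 := by
  obtain ⟨w, hw, hlen⟩ := exists_evalH_eq_wlenH_eq f hed
  obtain ⟨v, hv, hvlen⟩ := exists_wlenH_eq_ellH_evalH w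
  rw [← hw]
  exact le_antisymm (hlen ▸ ellH_le_wlenH w) (hvlen ▸ le_wlenH_of_evalH_eq he (hv.trans hw))
end

section
/- The group G has a normal subgroup of finite index which is free abelian of rank 10. -/
namespace NS

/-! ### The relations of `G` -/

theorem Gt_sq : Gt ^ 2 = 1 :=
  PresentedGroup.one_of_mem (rels := relsG) (x := gt ^ 2) (by simp [relsG])

theorem Gs_pow_four : Gs ^ 4 = 1 :=
  PresentedGroup.one_of_mem (rels := relsG) (x := gs ^ 4) (by simp [relsG])

theorem commute_Gs_Gt : Commute Gs Gt := by
  have h : Gs⁻¹ * Gt⁻¹ * Gs * Gt = 1 :=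
    PresentedGroup.one_of_mem (rels := relsG) (x := gs⁻¹ * gt⁻¹ * gs * gt) (by simp [relsG])
  calc Gs * Gt = Gt * Gs * (Gs⁻¹ * Gt⁻¹ * Gs * Gt) := by group
    _ = Gt * Gs := by rw [h, mul_one]

theorem commute_of_mem_basisG {a b : FG} (ha : a ∈ basisG) (hb : b ∈ basisG) :
    Commute (PresentedGroup.mk relsG a) (PresentedGroup.mk relsG b) := by
  have h : PresentedGroup.mk relsG (a * b * a⁻¹ * b⁻¹) = 1 :=
    PresentedGroup.one_of_mem (Or.inl (Or.inr ⟨a, ha, b, hb, rfl⟩))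
  rw [map_mul, map_mul, map_mul, map_inv, map_inv] at h
  rwa [mul_inv_eq_one, mul_inv_eq_iff_eq_mul] at h

theorem Gx_mul_cnj : Gx * cnj Gx (Gs ^ 2) = Gy * cnj Gy Gt := by
  have h : Gx * cnj Gx (Gs ^ 2) * (Gy * cnj Gy Gt)⁻¹ = 1 :=
    PresentedGroup.one_of_mem (rels := relsG)
      (x := gx * cnj gx (gs ^ 2) * (gy * cnj gy gt)⁻¹) (Or.inr rfl)
  rwa [mul_inv_eq_one] at h

theorem cnj_mul_right {Γ : Type*} [Group Γ] (a b c : Γ) : cnj a (b * c) = cnj (cnj a b) c := by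
  simp [cnj, mul_assoc]

theorem cnj_mul_left {Γ : Type*} [Group Γ] (a b c : Γ) : cnj (a * b) c = cnj a c * cnj b c := by
  simp [cnj, mul_assoc]

theorem map_cnj {Γ Δ : Type*} [Group Γ] [Group Δ] (f : Γ →* Δ) (a b : Γ) :
    f (cnj a b) = cnj (f a) (f b) := by
  simp [cnj]

/-- The finite abelian subgroup of `G` generated by `s` and `t`. -/
def subgroupST : Subgroup G where
  carrier := {g | ∃ i j : ℤ, g = Gt ^ j * Gs ^ i}
  one_mem' := ⟨0, 0, by simp⟩
  mul_mem' := by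
    rintro _ _ ⟨i, j, rfl⟩ ⟨k, l, rfl⟩
    refine ⟨i + k, j + l, ?_⟩
    rw [zpow_add, zpow_add, mul_assoc, mul_assoc, ← mul_assoc (Gs ^ i),
      (commute_Gs_Gt.zpow_zpow i l).eq, mul_assoc]
  inv_mem' := by
    rintro _ ⟨i, j, rfl⟩
    refine ⟨-i, -j, ?_⟩
    rw [mul_inv_rev, ← zpow_neg, ← zpow_neg, (commute_Gs_Gt.zpow_zpow _ _).eq]

theorem Gs_mem : Gs ∈ subgroupST := ⟨1, 0, by simp⟩

theorem Gt_mem : Gt ∈ subgroupST := ⟨0, 1, by simp⟩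

theorem exists_conjsG_of_mem {g : G} (hg : g ∈ subgroupST) :
    ∃ b ∈ conjsG, PresentedGroup.mk relsG b = g := by
  obtain ⟨i, j, rfl⟩ := hg
  have hs : Gs ^ i = Gs ^ (i % 4) := by
    conv_lhs => rw [← Int.emod_add_mul_ediv i 4, zpow_add, zpow_mul]
    rw [show Gs ^ (4 : ℤ) = 1 from mod_cast Gs_pow_four, one_zpow, mul_one]
  have ht : Gt ^ j = Gt ^ (j % 2) := by
    conv_lhs => rw [← Int.emod_add_mul_ediv j 2, zpow_add, zpow_mul]
    rw [show Gt ^ (2 : ℤ) = 1 from mod_cast Gt_sq, one_zpow, mul_one]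
  rw [hs, ht]
  have hi : i % 4 = 0 ∨ i % 4 = 1 ∨ i % 4 = 2 ∨ i % 4 = 3 := by omega
  have hj : j % 2 = 0 ∨ j % 2 = 1 := by omega
  have hS : PresentedGroup.mk relsG gs = Gs := rfl
  have hT : PresentedGroup.mk relsG gt = Gt := rfl
  rcases hi with h | h | h | h <;> rcases hj with h' | h' <;> rw [h, h'] <;>
    simp [conjsG, hS, hT]

instance : Finite subgroupST :=
  Set.Finite.subset ((List.finite_toSet conjsG).image (PresentedGroup.mk relsG)) fun _ hg =>
    exists_conjsG_of_mem hg

theorem mem_of_mul_eq_mul {Γ : Type*} [Group Γ] {K : Subgroup Γ} {a b c d : Γ}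
    (h : a * b = c * d) (ha : a ∈ K) (hb : b ∈ K) (hc : c ∈ K) : d ∈ K := by
  rw [eq_inv_mul_of_mul_eq h.symm]
  exact K.mul_mem (K.inv_mem hc) (K.mul_mem ha hb)

/-- The conjugates of `x` and `y` by elements of `⟨s, t⟩`. -/
def conjugates : Set G := {g | ∃ d ∈ subgroupST, g = cnj Gx d ∨ g = cnj Gy d}

theorem exists_basisG_of_mem {g : G} (hg : g ∈ conjugates) :
    ∃ b ∈ basisG, PresentedGroup.mk relsG b = g := by
  obtain ⟨d, hd, h⟩ := hg
  obtain ⟨b, hb, rfl⟩ := exists_conjsG_of_mem hd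
  rcases h with rfl | rfl
  · exact ⟨cnj gx b, List.mem_append_left _ (List.mem_map_of_mem hb), map_cnj _ _ _⟩
  · exact ⟨cnj gy b, List.mem_append_right _ (List.mem_map_of_mem hb), map_cnj _ _ _⟩

theorem commute_of_mem_conjugates {g h : G} (hg : g ∈ conjugates) (hh : h ∈ conjugates) :
    Commute g h := by
  obtain ⟨a, ha, rfl⟩ := exists_basisG_of_mem hg
  obtain ⟨b, hb, rfl⟩ := exists_basisG_of_mem hh
  exact commute_of_mem_basisG ha hb

theorem cnj_mem_conjugates {g d : G} (hg : g ∈ conjugates) (hd : d ∈ subgroupST) :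
    cnj g d ∈ conjugates := by
  obtain ⟨e, he, rfl | rfl⟩ := hg
  · exact ⟨e * d, mul_mem he hd, Or.inl (cnj_mul_right _ _ _).symm⟩
  · exact ⟨e * d, mul_mem he hd, Or.inr (cnj_mul_right _ _ _).symm⟩

theorem Gx_mem_conjugates : Gx ∈ conjugates := ⟨1, one_mem _, Or.inl (by simp [cnj])⟩

theorem Gy_mem_conjugates : Gy ∈ conjugates := ⟨1, one_mem _, Or.inr (by simp [cnj])⟩

/-- The subgroup of `G` generated by the conjugates of `x` and `y`. -/
def translationSubgroup : Subgroup G := Subgroup.closure conjugates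

theorem subgroupST_le_normalizer :
    subgroupST ≤ Subgroup.normalizer (translationSubgroup : Set G) := by
  have key : ∀ d ∈ subgroupST, ∀ n ∈ translationSubgroup, d * n * d⁻¹ ∈ translationSubgroup := by
    intro d hd n hn
    have : translationSubgroup ≤ translationSubgroup.comap (MulAut.conj d).toMonoidHom := by
      refine (Subgroup.closure_le _).2 fun c hc => Subgroup.subset_closure ?_
      simpa [cnj] using cnj_mem_conjugates hc (inv_mem hd)
    exact this hn
  intro d hd
  rw [Subgroup.mem_normalizer_iff]
  refine fun n => ⟨key d hd n, fun h => ?_⟩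
  have := key d⁻¹ (inv_mem hd) _ h
  simpa [mul_assoc] using this

theorem eq_top_of_generators_mem {K : Subgroup G} (hx : Gx ∈ K) (hy : Gy ∈ K) (hs : Gs ∈ K)
    (ht : Gt ∈ K) : K = ⊤ := by
  rw [eq_top_iff, ← PresentedGroup.closure_range_of relsG, Subgroup.closure_le]
  rintro _ ⟨_ | _ | _ | _, rfl⟩
  exacts [hx, hy, hs, ht]

instance translationSubgroup_normal : translationSubgroup.Normal := by
  rw [← Subgroup.normalizer_eq_top_iff]
  exact eq_top_of_generators_mem
    (Subgroup.le_normalizer (Subgroup.subset_closure Gx_mem_conjugates))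
    (Subgroup.le_normalizer (Subgroup.subset_closure Gy_mem_conjugates))
    (subgroupST_le_normalizer Gs_mem) (subgroupST_le_normalizer Gt_mem)

theorem translationSubgroup_finiteIndex : translationSubgroup.FiniteIndex := by
  have h : subgroupST ⊔ translationSubgroup = ⊤ := eq_top_of_generators_mem
    (Subgroup.mem_sup_right (Subgroup.subset_closure Gx_mem_conjugates))
    (Subgroup.mem_sup_right (Subgroup.subset_closure Gy_mem_conjugates))
    (Subgroup.mem_sup_left Gs_mem) (Subgroup.mem_sup_left Gt_mem)
  refine ⟨?_⟩
  rw [← Subgroup.relIndex_top_right, ← h, Subgroup.relIndex_sup_right]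
  exact Subgroup.FiniteIndex.index_ne_zero

/-! ### Ten generators of the translation subgroup -/

/-- Ten conjugates of `x` and `y` forming a basis of the translation subgroup. -/
def basisVec : Fin 10 → G :=
  ![Gx, cnj Gx (Gs ^ 2), cnj Gx Gt, Gy, cnj Gy (Gs ^ 2),
    cnj Gx Gs, cnj Gx (Gs ^ 3), cnj Gx (Gt * Gs), cnj Gy Gs, cnj Gy (Gs ^ 3)]

theorem basisVec_mem_conjugates (i : Fin 10) : basisVec i ∈ conjugates := by
  have hs := Gs_mem
  have ht := Gt_mem
  fin_cases i
  · exact Gx_mem_conjugates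
  · exact cnj_mem_conjugates Gx_mem_conjugates (pow_mem hs 2)
  · exact cnj_mem_conjugates Gx_mem_conjugates ht
  · exact Gy_mem_conjugates
  · exact cnj_mem_conjugates Gy_mem_conjugates (pow_mem hs 2)
  · exact cnj_mem_conjugates Gx_mem_conjugates hs
  · exact cnj_mem_conjugates Gx_mem_conjugates (pow_mem hs 3)
  · exact cnj_mem_conjugates Gx_mem_conjugates (mul_mem ht hs)
  · exact cnj_mem_conjugates Gy_mem_conjugates hs
  · exact cnj_mem_conjugates Gy_mem_conjugates (pow_mem hs 3)

theorem cnj_relation (d : G) :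
    cnj Gx d * cnj Gx (Gs ^ 2 * d) = cnj Gy d * cnj Gy (Gt * d) := by
  rw [cnj_mul_right, cnj_mul_right, ← cnj_mul_left, ← cnj_mul_left, Gx_mul_cnj]

theorem closure_basisVec : Subgroup.closure (Set.range basisVec) = translationSubgroup := by
  refine le_antisymm (Subgroup.closure_mono ?_) ((Subgroup.closure_le _).2 ?_)
  · rintro _ ⟨i, rfl⟩
    exact basisVec_mem_conjugates i
  set K := Subgroup.closure (Set.range basisVec)
  have hb (i : Fin 10) : basisVec i ∈ K := Subgroup.subset_closure ⟨i, rfl⟩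
  have x0 : cnj Gx 1 ∈ K := by simpa [cnj, basisVec] using hb 0
  have x1 : cnj Gx Gs ∈ K := hb 5
  have x2 : cnj Gx (Gs ^ 2) ∈ K := hb 1
  have x3 : cnj Gx (Gs ^ 3) ∈ K := hb 6
  have y0 : cnj Gy 1 ∈ K := by simpa [cnj, basisVec] using hb 3
  have y1 : cnj Gy Gs ∈ K := hb 8
  have y2 : cnj Gy (Gs ^ 2) ∈ K := hb 4
  have y3 : cnj Gy (Gs ^ 3) ∈ K := hb 9
  have xt0 : cnj Gx Gt ∈ K := hb 2
  have xt1 : cnj Gx (Gt * Gs) ∈ K := hb 7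
  have s4 : Gs ^ 2 * Gs ^ 2 = 1 := by rw [← pow_add, Gs_pow_four]
  have s5 : Gs ^ 2 * Gs ^ 3 = Gs := by rw [← pow_add, pow_succ, Gs_pow_four, one_mul]
  have t2 : Gt * Gt = 1 := by rw [← pow_two, Gt_sq]
  have st : Gs ^ 2 * Gt = Gt * Gs ^ 2 := (commute_Gs_Gt.pow_left 2).eq
  have yt0 : cnj Gy Gt ∈ K := by
    have h := cnj_relation 1
    rw [mul_one, mul_one] at h
    exact mem_of_mul_eq_mul h x0 x2 y0
  have yt1 : cnj Gy (Gt * Gs) ∈ K := by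
    have h := cnj_relation Gs
    rw [← pow_succ] at h
    exact mem_of_mul_eq_mul h x1 x3 y1
  have yt2 : cnj Gy (Gt * Gs ^ 2) ∈ K := by
    have h := cnj_relation (Gs ^ 2)
    rw [s4] at h
    exact mem_of_mul_eq_mul h x2 x0 y2
  have yt3 : cnj Gy (Gt * Gs ^ 3) ∈ K := by
    have h := cnj_relation (Gs ^ 3)
    rw [s5] at h
    exact mem_of_mul_eq_mul h x3 x1 y3
  have xt2 : cnj Gx (Gt * Gs ^ 2) ∈ K := by
    have h := cnj_relation Gt
    rw [st, t2] at h
    exact mem_of_mul_eq_mul h.symm yt0 y0 xt0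
  have xt3 : cnj Gx (Gt * Gs ^ 3) ∈ K := by
    have h := cnj_relation (Gt * Gs)
    rw [← mul_assoc, ← mul_assoc, st, t2, one_mul, mul_assoc Gt, ← pow_succ] at h
    exact mem_of_mul_eq_mul h.symm yt1 y1 xt1
  intro g hg
  obtain ⟨a, ha, rfl⟩ := exists_basisG_of_mem hg
  have hX : PresentedGroup.mk relsG gx = Gx := rfl
  have hY : PresentedGroup.mk relsG gy = Gy := rfl
  have hS : PresentedGroup.mk relsG gs = Gs := rfl
  have hT : PresentedGroup.mk relsG gt = Gt := rfl
  simp only [basisG, conjsG, List.map_cons, List.map_nil, List.cons_append, List.nil_append,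
    List.mem_cons, List.not_mem_nil, or_false] at ha
  rcases ha with rfl | rfl | rfl | rfl | rfl | rfl | rfl | rfl | rfl | rfl | rfl | rfl | rfl |
    rfl | rfl | rfl <;>
    simpa only [map_cnj, map_mul, map_pow, map_one, hX, hY, hS, hT, SetLike.mem_coe]

/-- The homomorphism from `ℤ¹⁰` to `G` determined by `basisVec`. -/
noncomputable def ofVec : (Fin 10 → Multiplicative ℤ) →* G :=
  MonoidHom.noncommPiCoprod (fun i => zpowersHom G (basisVec i)) fun i j _ m n => by
    simpa using (commute_of_mem_conjugates (basisVec_mem_conjugates i)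
      (basisVec_mem_conjugates j)).zpow_zpow _ _

theorem ofVec_range : ofVec.range = translationSubgroup := by
  rw [← closure_basisVec, ← Set.iUnion_singleton_eq_range, Subgroup.closure_iUnion]
  refine (MonoidHom.noncommPiCoprod_range _).trans ?_
  simp only [← Subgroup.zpowers_eq_closure]
  exact iSup_congr fun i => Subgroup.ext fun g => Iff.rfl

/-! ### The affine action of `G` on `ℤ¹⁰` -/

/-- Translations of an additive commutative group, as permutations. -/
def translation (V : Type*) [AddCommGroup V] : Multiplicative V →* Equiv.Perm V where
  toFun v := Equiv.addLeft v.toAdd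
  map_one' := by ext; simp
  map_mul' v w := by ext; simp

/-- The additive permutations of an additive commutative group. -/
def additivePerm (V : Type*) [AddCommGroup V] : Subgroup (Equiv.Perm V) where
  carrier := {A | ∀ v w, A (v + w) = A v + A w}
  one_mem' _ _ := rfl
  mul_mem' hA hB v w := by simp [hB v w, hA _ _]
  inv_mem' {A} hA v w := A.injective (by simp [hA _ _])

theorem cnj_translation {V : Type*} [AddCommGroup V] (v : V) {A : Equiv.Perm V}
    (hA : A ∈ additivePerm V) :
    cnj (translation V (Multiplicative.ofAdd v)) A =
      translation V (Multiplicative.ofAdd (A⁻¹ v)) := by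
  ext w
  change A⁻¹ (v + A w) = A⁻¹ v + w
  simp [inv_mem hA v (A w)]

/-- The action of `s`; its inverse sends each basis vector to its conjugate by `s`. -/
def actS : Equiv.Perm (Fin 10 → ℤ) where
  toFun v := ![v 5, v 6, v 7, v 8, v 9, v 1 + v 2, v 0 + v 2, -v 2, v 4, v 3]
  invFun v := ![v 6 + v 7, v 5 + v 7, -v 7, v 9, v 8, v 0, v 1, v 2, v 3, v 4]
  left_inv v := by ext i; fin_cases i <;> simp
  right_inv v := by ext i; fin_cases i <;> simp

theorem actS_mem : actS ∈ additivePerm (Fin 10 → ℤ) := by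
  intro v w
  ext i
  fin_cases i <;> simp [actS] <;> ring

/-- The action of `t`, an involution. -/
def actT : Equiv.Perm (Fin 10 → ℤ) where
  toFun v := ![v 1 + v 2 + v 3 + v 4, v 1 + v 3 + v 4, v 0 - v 1, -v 3, -v 4,
    v 6 + v 7 + v 8 + v 9, v 6 + v 8 + v 9, v 5 - v 6, -v 8, -v 9]
  invFun v := ![v 1 + v 2 + v 3 + v 4, v 1 + v 3 + v 4, v 0 - v 1, -v 3, -v 4,
    v 6 + v 7 + v 8 + v 9, v 6 + v 8 + v 9, v 5 - v 6, -v 8, -v 9]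
  left_inv v := by ext i; fin_cases i <;> simp <;> ring
  right_inv v := by ext i; fin_cases i <;> simp <;> ring

theorem actT_mem : actT ∈ additivePerm (Fin 10 → ℤ) := by
  intro v w
  ext i
  fin_cases i <;> simp [actT] <;> ring

/-- The images of the generators of `G` in the affine group of `ℤ¹⁰`. -/
def affineGen : GenG → Equiv.Perm (Fin 10 → ℤ)
  | GenG.x => translation _ (Multiplicative.ofAdd (Pi.single 0 1))
  | GenG.y => translation _ (Multiplicative.ofAdd (Pi.single 3 1))
  | GenG.s => actS
  | GenG.t => actT

theorem lift_affineGen_conjsG {b : FG} (hb : b ∈ conjsG) :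
    FreeGroup.lift affineGen b ∈ additivePerm (Fin 10 → ℤ) := by
  have hs : FreeGroup.lift affineGen gs ∈ additivePerm (Fin 10 → ℤ) := by
    simpa [gs, affineGen] using actS_mem
  have ht : FreeGroup.lift affineGen gt ∈ additivePerm (Fin 10 → ℤ) := by
    simpa [gt, affineGen] using actT_mem
  simp only [conjsG, List.mem_cons, List.not_mem_nil, or_false] at hb
  rcases hb with rfl | rfl | rfl | rfl | rfl | rfl | rfl | rfl <;>
    simp only [map_one, map_mul, map_pow, one_mem, mul_mem, pow_mem, hs, ht]

theorem lift_affineGen_basisG {a : FG} (ha : a ∈ basisG) :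
    ∃ v, FreeGroup.lift affineGen a = translation (Fin 10 → ℤ) v := by
  rw [basisG, List.mem_append, List.mem_map, List.mem_map] at ha
  rcases ha with ⟨b, hb, rfl⟩ | ⟨b, hb, rfl⟩ <;>
  · rw [map_cnj]
    simp only [gx, gy, FreeGroup.lift_apply_of, affineGen,
      cnj_translation _ (lift_affineGen_conjsG hb)]
    exact ⟨_, rfl⟩

theorem affineGen_relation :
    affineGen GenG.x * cnj (affineGen GenG.x) (affineGen GenG.s ^ 2) =
      affineGen GenG.y * cnj (affineGen GenG.y) (affineGen GenG.t) := by
  simp only [affineGen, cnj_translation _ (pow_mem actS_mem 2), cnj_translation _ actT_mem,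
    ← map_mul, ← ofAdd_add]
  congr 2
  ext i
  fin_cases i <;> rfl

theorem lift_affineGen_relsG : ∀ r ∈ relsG, FreeGroup.lift affineGen r = 1 := by
  rintro r (((rfl | rfl | rfl) | ⟨a, ha, b, hb, rfl⟩) | rfl)
  · ext v i
    fin_cases i <;> simp [gt, affineGen, actT, pow_succ] <;> ring
  · ext v i
    fin_cases i <;> simp [gs, affineGen, actS, pow_succ]
  · have h : affineGen GenG.s * affineGen GenG.t = affineGen GenG.t * affineGen GenG.s := by
      ext v i
      fin_cases i <;> simp [affineGen, actS, actT] <;> ring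
    simp only [map_mul, map_inv, gs, gt, FreeGroup.lift_apply_of]
    rw [mul_assoc, h]
    group
  · obtain ⟨v, hv⟩ := lift_affineGen_basisG ha
    obtain ⟨w, hw⟩ := lift_affineGen_basisG hb
    rw [map_mul, map_mul, map_mul, map_inv, map_inv, hv, hw, ← map_mul, mul_comm v w, map_mul]
    group
  · rw [map_mul, map_inv, mul_inv_eq_one, map_mul, map_mul, map_cnj, map_cnj, map_pow]
    simpa [gx, gy, gs, gt] using affineGen_relation

/-- The action of `G` on `ℤ¹⁰` by affine maps. -/
def affineAction : G →* Equiv.Perm (Fin 10 → ℤ) :=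
  PresentedGroup.toGroup lift_affineGen_relsG

theorem affineAction_basisVec (i : Fin 10) :
    affineAction (basisVec i) = translation _ (Multiplicative.ofAdd (Pi.single i 1)) := by
  have hx : affineAction Gx = translation _ (Multiplicative.ofAdd (Pi.single 0 1)) :=
    PresentedGroup.toGroup.of lift_affineGen_relsG
  have hy : affineAction Gy = translation _ (Multiplicative.ofAdd (Pi.single 3 1)) :=
    PresentedGroup.toGroup.of lift_affineGen_relsG
  have hs : affineAction Gs = actS := PresentedGroup.toGroup.of lift_affineGen_relsG
  have ht : affineAction Gt = actT := PresentedGroup.toGroup.of lift_affineGen_relsG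
  fin_cases i <;>
    simp only [basisVec, Fin.reduceFinMk, Fin.zero_eta, Fin.mk_one, Fin.isValue,
      Matrix.cons_val, Matrix.cons_val_zero, Matrix.cons_val_one, map_cnj, map_mul, map_pow,
      hx, hy, hs, ht, cnj_translation _ actS_mem, cnj_translation _ actT_mem,
      cnj_translation _ (pow_mem actS_mem 2), cnj_translation _ (pow_mem actS_mem 3),
      cnj_translation _ (mul_mem actT_mem actS_mem)] <;>
    congr 2 <;> ext j <;> fin_cases j <;> rfl

theorem affineAction_comp_ofVec :
    affineAction.comp ofVec = (translation (Fin 10 → ℤ)).comp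
      (MulEquiv.piMultiplicative fun _ : Fin 10 => ℤ).symm.toMonoidHom := by
  refine MonoidHom.pi_ext fun i m => ?_
  have : ofVec (Pi.mulSingle i m) = basisVec i ^ m.toAdd := 
    (MonoidHom.noncommPiCoprod_mulSingle _ _ _).trans rfl
  rw [MonoidHom.comp_apply, this, map_zpow, affineAction_basisVec, ← map_zpow, ← ofAdd_zsmul]
  rw [MonoidHom.comp_apply]
  congr 1
  refine Multiplicative.toAdd.injective (funext fun j => ?_)
  change (m.toAdd • Pi.single i (1 : ℤ) : Fin 10 → ℤ) j =
    (Pi.mulSingle i m : Fin 10 → Multiplicative ℤ) j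
  obtain rfl | h := eq_or_ne j i
  · rw [Pi.mulSingle_eq_same, Pi.smul_apply, Pi.single_eq_same, smul_eq_mul, mul_one]
    rfl
  · rw [Pi.mulSingle_eq_of_ne h, Pi.smul_apply, Pi.single_eq_of_ne h, smul_zero]
    rfl

theorem ofVec_injective : Function.Injective ofVec := by
  refine Function.Injective.of_comp (f := affineAction) ?_
  rw [← MonoidHom.coe_comp, affineAction_comp_ofVec]
  intro v w h
  have := congrArg (fun p : Equiv.Perm (Fin 10 → ℤ) => p 0) h
  refine (MulEquiv.piMultiplicative fun _ : Fin 10 => ℤ).symm.injective ?_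
  simpa [translation] using this

end NS

open NS in
/-- The group `G` has a normal subgroup of finite index which is free abelian of
rank 10. -/
theorem G_has_finite_index_normal_free_abelian_rank_ten :
    ∃ N : Subgroup G, N.Normal ∧ N.FiniteIndex ∧
      Nonempty (N ≃* Multiplicative (Fin 10 → ℤ)) := by
  refine ⟨translationSubgroup, translationSubgroup_normal, translationSubgroup_finiteIndex, ⟨?_⟩⟩
  rw [← ofVec_range]
  exact (MonoidHom.ofInjective ofVec_injective).symm.trans
    (MulEquiv.piMultiplicative fun _ : Fin 10 => ℤ).symm
end
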